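/- Let λ, μ > 0. Then for every k ∈ ℤ and t ≥ 0, each p_{k,n}(t;λ,μ) is nonnegative and the series Σ_{n∈ℤ} p_{k,n}(t;λ,μ) converges with sum equal to 1. -/

import Mathlib

open scoped BigOperators

/-- Inner binomial sum `∑_{k=0}^{n-m} C(n,k) C(n,k+m) ρ^{-2k-m}`. -/
noncomputable def innerSum (ρ : ℝ) (m n : ℕ) : ℝ :=
  ∑ k ∈ Finset.range (n - m + 1),
    (n.choose k : ℝ) * (n.choose (k + m) : ℝ) * ρ ^ (-(2 * (k : ℤ) + (m : ℤ)))

/-- Series `∑_{n≥m} [x^{2n}/(2n)! + c·x^{2n+1}/(2n+1)!]·innerSum ρ m n`. -/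
noncomputable def evenSeries (x c ρ : ℝ) (m : ℕ) : ℝ :=
  ∑' j : ℕ,
    ((x ^ (2 * (m + j)) / (2 * (m + j)).factorial) +
      c * (x ^ (2 * (m + j) + 1) / (2 * (m + j) + 1).factorial)) * innerSum ρ m (m + j)

/-- Series `∑_{n≥m} x^{2n+1}/(2n+1)!·innerSum ρ m n`. -/
noncomputable def oddSeries (x ρ : ℝ) (m : ℕ) : ℝ :=
  ∑' j : ℕ,
    (x ^ (2 * (m + j) + 1) / (2 * (m + j) + 1).factorial) * innerSum ρ m (m + j)

/-- `p_{2l,2r}(t;λ,μ)`. -/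
noncomputable def pEE (lam mu t : ℝ) (l r : ℤ) : ℝ :=
  Real.exp (-(lam + mu) * t) *
    evenSeries (lam * t) ((mu - lam) / lam) (lam / mu) (r - l).natAbs

/-- `p_{2l,2r+1}(t;λ,μ)`. -/
noncomputable def pEO (lam mu t : ℝ) (l r : ℤ) : ℝ :=
  Real.exp (-(lam + mu) * t) *
    (oddSeries (lam * t) (lam / mu) (r - l).natAbs +
      oddSeries (lam * t) (lam / mu) (r - l + 1).natAbs)

/-- `p_{2l+1,2r}(t;λ,μ)`. -/
noncomputable def pOE (lam mu t : ℝ) (l r : ℤ) : ℝ :=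
  Real.exp (-(lam + mu) * t) *
    (oddSeries (mu * t) (mu / lam) (r - l - 1).natAbs +
      oddSeries (mu * t) (mu / lam) (r - l).natAbs)

/-- `p_{2l+1,2r+1}(t;λ,μ)`. -/
noncomputable def pOO (lam mu t : ℝ) (l r : ℤ) : ℝ :=
  Real.exp (-(lam + mu) * t) *
    evenSeries (mu * t) ((lam - mu) / mu) (mu / lam) (r - l).natAbs

/-- Transition probability `p_{k,n}(t;λ,μ)`, by parity of the states. -/
noncomputable def transP (lam mu t : ℝ) (k n : ℤ) : ℝ :=
  if k % 2 = 0 then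
    if n % 2 = 0 then pEE lam mu t (k / 2) (n / 2)
    else pEO lam mu t (k / 2) ((n - 1) / 2)
  else
    if n % 2 = 0 then pOE lam mu t ((k - 1) / 2) (n / 2)
    else pOO lam mu t ((k - 1) / 2) ((n - 1) / 2)

/-- `h(z) = √((μz²+λ)(λz²+μ))`. -/
noncomputable def hFun (lam mu z : ℝ) : ℝ := Real.sqrt ((mu * z ^ 2 + lam) * (lam * z ^ 2 + mu))

theorem aux_hasSum_inner (ρ : ℝ) (m n : ℕ) :
    HasSum (fun k : ℕ => (n.choose k : ℝ) * (n.choose (k + m) : ℝ) * ρ⁻¹ ^ (2 * k + m))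
      (innerSum ρ m n) := by
  have h := hasSum_sum_of_ne_finset_zero (L := SummationFilter.unconditional ℕ) (s := Finset.range (n - m + 1))
    (f := fun k : ℕ => (n.choose k : ℝ) * (n.choose (k + m) : ℝ) * ρ⁻¹ ^ (2 * k + m)) (by
      intro k hk
      have hk' : n < k + m := by
        simp only [Finset.mem_range] at hk
        omega
      simp [Nat.choose_eq_zero_of_lt hk'])
  convert h using 1
  unfold innerSum
  refine Finset.sum_congr rfl fun k _ => ?_
  congr 1
  rw [zpow_neg, inv_pow]
  norm_cast

theorem aux_inner_nonneg (ρ : ℝ) (hρ : 0 < ρ) (m n : ℕ) : 0 ≤ innerSum ρ m n := by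
  refine (aux_hasSum_inner ρ m n).nonneg fun k => ?_
  positivity

theorem aux_inner_mono (ρ : ℝ) (hρ : 0 < ρ) (m n : ℕ) :
    innerSum ρ m n ≤ innerSum ρ m (n + 1) := by
  refine hasSum_le (fun k => ?_) (aux_hasSum_inner ρ m n) (aux_hasSum_inner ρ m (n + 1))
  have h1 : (n.choose k : ℝ) ≤ ((n + 1).choose k : ℝ) := by
    exact_mod_cast Nat.choose_le_choose k (Nat.le_succ n)
  have h2 : (n.choose (k + m) : ℝ) ≤ ((n + 1).choose (k + m) : ℝ) := by
    exact_mod_cast Nat.choose_le_choose (k + m) (Nat.le_succ n)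
  gcongr

theorem aux_inner_zero (ρ : ℝ) (m n : ℕ) (h : n < m) : innerSum ρ m n = 0 := by
  unfold innerSum
  refine Finset.sum_eq_zero fun k _ => ?_
  have hk' : n < k + m := by omega
  simp [Nat.choose_eq_zero_of_lt hk']

/-- `(i, j) ↦ (i - j, min i j)`. -/
def auxEquiv : ℤ × ℕ ≃ ℕ × ℕ where
  toFun p := (p.2 + p.1.toNat, p.2 + (-p.1).toNat)
  invFun p := ((p.1 : ℤ) - p.2, min p.1 p.2)
  left_inv := by
    rintro ⟨m, k⟩
    ext <;> simp <;> omega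
  right_inv := by
    rintro ⟨m, k⟩
    ext <;> simp <;> omega

theorem aux_inner_sum (ρ : ℝ) (n : ℕ) :
    HasSum (fun m : ℤ => innerSum ρ m.natAbs n) ((1 + ρ⁻¹) ^ (2 * n)) := by
  set q := ρ⁻¹ with hq
  have h1 : HasSum (fun i : ℕ => (n.choose i : ℝ) * q ^ i) ((1 + q) ^ n) := by
    have h := hasSum_sum_of_ne_finset_zero (L := SummationFilter.unconditional ℕ) (s := Finset.range (n + 1))
      (f := fun i : ℕ => (n.choose i : ℝ) * q ^ i) (by
        intro k hk
        have hk' : n < k := by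
          simp only [Finset.mem_range] at hk
          omega
        simp [Nat.choose_eq_zero_of_lt hk'])
    convert h using 1
    rw [add_comm, add_pow]
    refine Finset.sum_congr rfl fun k _ => ?_
    simp [mul_comm]
  have hfin : (Function.support (fun p : ℕ × ℕ =>
      ((n.choose p.1 : ℝ) * q ^ p.1) * ((n.choose p.2 : ℝ) * q ^ p.2))).Finite := by
    refine Set.Finite.subset ((Finset.range (n + 1) ×ˢ Finset.range (n + 1)).finite_toSet) ?_
    rintro ⟨i, j⟩ h
    simp only [Finset.coe_product, Finset.coe_range, Set.mem_prod, Set.mem_Iio]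
    by_contra hcon
    apply h
    have : n < i ∨ n < j := by omega
    rcases this with h | h <;> simp [Nat.choose_eq_zero_of_lt h]
  have h2 := h1.mul h1 (summable_of_hasFiniteSupport hfin)
  rw [← auxEquiv.hasSum_iff] at h2
  have h3 := h2.prod_fiberwise (g := fun m : ℤ => innerSum ρ m.natAbs n) (by
    intro m
    refine (aux_hasSum_inner ρ m.natAbs n).congr_fun ?_
    intro k
    simp only [auxEquiv, Function.comp, Equiv.coe_fn_mk]
    rcases le_total 0 m with h | h
    · have e1 : m.toNat = m.natAbs := by omega
      have e2 : (-m).toNat = 0 := by omega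
      rw [e1, e2, ← hq]
      simp only [add_zero]
      ring
    · have e1 : (-m).toNat = m.natAbs := by omega
      have e2 : m.toNat = 0 := by omega
      rw [e1, e2, ← hq]
      simp only [add_zero]
      ring)
  rw [two_mul, pow_add]
  exact h3

/-- Weighted sums. -/
theorem aux_weighted (ρ : ℝ) (hρ : 0 < ρ) (w : ℕ → ℝ) (hw : ∀ n, 0 ≤ w n) (S : ℝ)
    (hS : HasSum (fun n => w n * (1 + ρ⁻¹) ^ (2 * n)) S) :
    (∀ m : ℕ, Summable fun j : ℕ => w (m + j) * innerSum ρ m (m + j)) ∧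
    HasSum (fun m : ℤ => ∑' j : ℕ, w (m.natAbs + j) * innerSum ρ m.natAbs (m.natAbs + j)) S := by
  have hrow : ∀ n, HasSum (fun m : ℤ => w n * innerSum ρ m.natAbs n)
      (w n * (1 + ρ⁻¹) ^ (2 * n)) := fun n => (aux_inner_sum ρ n).mul_left _
  have hsum : Summable (fun p : ℕ × ℤ => w p.1 * innerSum ρ p.2.natAbs p.1) := by
    rw [summable_prod_of_nonneg]
    · refine ⟨fun n => (hrow n).summable, ?_⟩
      refine hS.summable.congr fun n => ?_
      exact (hrow n).tsum_eq.symm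
    · intro p
      exact mul_nonneg (hw _) (aux_inner_nonneg ρ hρ _ _)
  have htot : HasSum (fun p : ℕ × ℤ => w p.1 * innerSum ρ p.2.natAbs p.1) S := by
    have h := hsum.hasSum
    have h2 := h.prod_fiberwise hrow
    rwa [h2.unique hS] at h
  have hswap : HasSum (fun p : ℤ × ℕ => w p.2 * innerSum ρ p.1.natAbs p.2) S :=
    ((Equiv.prodComm ℤ ℕ).hasSum_iff
      (f := fun p : ℕ × ℤ => w p.1 * innerSum ρ p.2.natAbs p.1) (a := S)).mpr htot
  have hcol : ∀ m : ℤ, Summable (fun n : ℕ => w n * innerSum ρ m.natAbs n) :=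
    fun m => hswap.summable.prod_factor m
  refine ⟨fun m => ?_, ?_⟩
  · have h := (summable_nat_add_iff m).mpr (hcol m)
    refine h.congr fun j => ?_
    simp only [Int.natAbs_natCast]
    rw [add_comm m j]
  · refine (hswap.prod_fiberwise fun m => (hcol m).hasSum).congr_fun ?_
    intro m
    rw [← (hcol m).sum_add_tsum_nat_add m.natAbs, Finset.sum_eq_zero, zero_add]
    · exact tsum_congr fun j => by rw [add_comm]
    · intro n hn
      rw [aux_inner_zero ρ _ _ (Finset.mem_range.mp hn), mul_zero]

/-- Sign of the remainder of the alternating exponential series. -/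
theorem aux_rem (N : ℕ) : ∀ x : ℝ, 0 ≤ x →
    0 ≤ (-1) ^ N * (Real.exp (-x) - ∑ n ∈ Finset.range N, (-x) ^ n / n.factorial) := by
  induction N with
  | zero => intro x _; simp [Real.exp_nonneg]
  | succ N ih =>
    intro x hx
    set F : ℝ → ℝ := fun x =>
      (-1) ^ (N + 1) * (Real.exp (-x) - ∑ n ∈ Finset.range (N + 1), (-x) ^ n / n.factorial)
      with hF
    have hd : ∀ y, HasDerivAt F
        ((-1) ^ N * (Real.exp (-y) - ∑ n ∈ Finset.range N, (-y) ^ n / n.factorial)) y := by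
      intro y
      have hneg : HasDerivAt (fun y : ℝ => -y) (-1) y := hasDerivAt_neg y
      have h1 : HasDerivAt (fun y : ℝ => ∑ n ∈ Finset.range (N + 1), (-y) ^ n / n.factorial)
          (∑ n ∈ Finset.range (N + 1), ((n : ℝ) * (-y) ^ (n - 1) * (-1)) / n.factorial) y := by
        refine HasDerivAt.fun_sum fun n _ => ?_
        exact (hneg.pow n).div_const _
      have h2 := ((hneg.exp.sub h1).const_mul ((-1 : ℝ) ^ (N + 1)))
      refine h2.congr_deriv ?_
      rw [Finset.sum_range_succ']
      have : ∀ n ∈ Finset.range N, (((n + 1 : ℕ) : ℝ) * (-y) ^ (n + 1 - 1) * (-1)) /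
          (n + 1).factorial = - ((-y) ^ n / n.factorial) := by
        intro n _
        rw [Nat.factorial_succ]
        push_cast
        have : (n.factorial : ℝ) ≠ 0 := by positivity
        have : (n + 1 : ℝ) ≠ 0 := by positivity
        field_simp
      rw [Finset.sum_congr rfl this, Finset.sum_neg_distrib]
      simp only [Nat.cast_zero, zero_mul, zero_div, add_zero]
      ring
    have hmono : MonotoneOn F (Set.Ici 0) := by
      refine monotoneOn_of_deriv_nonneg (convex_Ici 0)
        (fun y _ => (hd y).continuousAt.continuousWithinAt)
        (fun y _ => (hd y).differentiableAt.differentiableWithinAt) ?_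
      intro y hy
      rw [(hd y).deriv]
      rw [interior_Ici] at hy
      exact ih y (le_of_lt hy)
    have h0 : F 0 = 0 := by
      simp [hF, Finset.sum_range_succ']
    have := hmono (Set.mem_Ici.mpr le_rfl) (Set.mem_Ici.mpr hx) hx
    rw [h0] at this
    exact this

theorem aux_tail (x c : ℝ) (hx : 0 ≤ x) (hc : -1 ≤ c) (M : ℕ) :
    0 ≤ ∑' j : ℕ, ((x ^ (2 * (M + j)) / (2 * (M + j)).factorial) +
      c * (x ^ (2 * (M + j) + 1) / (2 * (M + j) + 1).factorial)) := by
  have hE : Summable (fun j : ℕ => x ^ (2 * (M + j)) / ((2 * (M + j)).factorial : ℝ)) := by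
    have h := (summable_nat_add_iff M).mpr (Real.hasSum_cosh x).summable
    exact h.congr fun j => by rw [add_comm M j]
  have hO : Summable
      (fun j : ℕ => x ^ (2 * (M + j) + 1) / ((2 * (M + j) + 1).factorial : ℝ)) := by
    have h := (summable_nat_add_iff M).mpr (Real.hasSum_sinh x).summable
    exact h.congr fun j => by rw [add_comm M j]
  have hexp : HasSum (fun n : ℕ => (-x) ^ n / (n.factorial : ℝ)) (Real.exp (-x)) := by
    rw [Real.exp_eq_exp_ℝ]
    exact NormedSpace.expSeries_div_hasSum_exp (-x)
  have ht := (hasSum_nat_add_iff' (2 * M)).mpr hexp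
  have hr := aux_rem (2 * M) x hx
  rw [pow_mul] at hr
  norm_num at hr
  have heo : HasSum (fun n : ℕ => (-x) ^ (n + 2 * M) / ((n + 2 * M).factorial : ℝ))
      (∑' j : ℕ, x ^ (2 * (M + j)) / ((2 * (M + j)).factorial : ℝ) +
        -∑' j : ℕ, x ^ (2 * (M + j) + 1) / ((2 * (M + j) + 1).factorial : ℝ)) := by
    refine HasSum.even_add_odd ?_ ?_
    · refine hE.hasSum.congr_fun fun j => ?_
      have e : 2 * j + 2 * M = 2 * (M + j) := by ring
      rw [e, pow_mul, pow_mul, neg_sq]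
    · refine hO.hasSum.neg.congr_fun fun j => ?_
      have e : 2 * j + 1 + 2 * M = 2 * (M + j) + 1 := by ring
      rw [e, pow_succ, pow_succ, pow_mul, pow_mul, neg_sq]
      ring
  have hval := ht.unique heo
  rw [(hE.hasSum.add (hO.hasSum.mul_left c)).tsum_eq]
  have hOn : 0 ≤ ∑' j : ℕ, x ^ (2 * (M + j) + 1) / ((2 * (M + j) + 1).factorial : ℝ) :=
    tsum_nonneg fun j => by positivity
  nlinarith

theorem aux_abel (A u : ℕ → ℝ) (hA : ∀ n, 0 ≤ A n) (hm : Monotone A) (hu : Summable u)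
    (hAu : Summable fun n => u n * A n) (ht : ∀ N, 0 ≤ ∑' j, u (N + j)) :
    0 ≤ ∑' n, u n * A n := by
  have hP : ∀ N, 0 ≤ ∑ n ∈ Finset.range N, u n * A n + A N * ∑' j, u (N + j) := by
    intro N
    induction N with
    | zero => simpa using mul_nonneg (hA 0) (by simpa using ht 0)
    | succ N ih =>
      have hs : Summable fun j => u (N + j) := by
        simpa [add_comm] using (summable_nat_add_iff N).mpr hu
      have h1 : ∑' j, u (N + j) = u N + ∑' j, u (N + 1 + j) := by
        rw [hs.tsum_eq_zero_add]
        simp [add_assoc, add_comm 1]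
      rw [Finset.sum_range_succ]
      have h2 := mul_nonneg (sub_nonneg.mpr (hm (Nat.le_succ N))) (ht (N + 1))
      rw [h1] at ih
      simp only [Nat.succ_eq_add_one] at h2
      nlinarith
  have hlim := tendsto_sum_nat_add (fun n => |u n * A n|)
  have hsum := hAu.hasSum.tendsto_sum_nat
  have hadd := hsum.add hlim
  rw [add_zero] at hadd
  refine ge_of_tendsto' hadd fun N => (hP N).trans ?_
  gcongr
  have hs : Summable fun j => u (j + N) := (summable_nat_add_iff N).mpr hu
  have hs2 : Summable fun j => |u (j + N) * A (j + N)| := (summable_nat_add_iff N).mpr hAu.abs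
  have e : ∑' j, u (N + j) = ∑' j, u (j + N) := by simp [add_comm]
  rw [e, ← tsum_mul_left]
  refine (hs.mul_left _).tsum_le_tsum (fun j => ?_) hs2
  rw [abs_mul, abs_of_nonneg (hA (j + N)), mul_comm]
  have h1 : A N ≤ A (j + N) := hm (by omega)
  calc u (j + N) * A N ≤ |u (j + N)| * A N :=
        mul_le_mul_of_nonneg_right (le_abs_self _) (hA N)
    _ ≤ _ := mul_le_mul_of_nonneg_left h1 (abs_nonneg _)

/-- Everything needed about the two series. -/
theorem aux_series (lam mu t : ℝ) (hlam : 0 < lam) (hmu : 0 < mu) (ht : 0 ≤ t) :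
    (∀ m, 0 ≤ evenSeries (lam * t) ((mu - lam) / lam) (lam / mu) m) ∧
    (∀ m, 0 ≤ oddSeries (lam * t) (lam / mu) m) ∧
    HasSum (fun m : ℤ => evenSeries (lam * t) ((mu - lam) / lam) (lam / mu) m.natAbs)
      (Real.cosh ((lam + mu) * t) + (mu - lam) / (lam + mu) * Real.sinh ((lam + mu) * t)) ∧
    HasSum (fun m : ℤ => oddSeries (lam * t) (lam / mu) m.natAbs)
      (lam / (lam + mu) * Real.sinh ((lam + mu) * t)) := by
  have hx : 0 ≤ lam * t := by positivity
  have hρ : 0 < lam / mu := by positivity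
  have hs : lam * t * (1 + (lam / mu)⁻¹) = (lam + mu) * t := by field_simp
  have hq : (1 + (lam / mu)⁻¹) = (lam + mu) / lam := by field_simp
  have hc : -1 ≤ (mu - lam) / lam := by
    rw [le_div_iff₀ hlam]
    linarith
  obtain ⟨hE1, hE2⟩ := aux_weighted (lam / mu) hρ
    (fun n => (lam * t) ^ (2 * n) / (2 * n).factorial) (fun n => by positivity)
    (Real.cosh ((lam + mu) * t)) (by
      refine (Real.hasSum_cosh _).congr_fun fun n => ?_
      rw [← hs, mul_pow (lam * t)]
      ring)
  obtain ⟨hO1, hO2⟩ := aux_weighted (lam / mu) hρ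
    (fun n => (lam * t) ^ (2 * n + 1) / (2 * n + 1).factorial) (fun n => by positivity)
    (lam / (lam + mu) * Real.sinh ((lam + mu) * t)) (by
      refine ((Real.hasSum_sinh _).mul_left _).congr_fun fun n => ?_
      rw [← hs, mul_pow (lam * t), pow_succ (1 + (lam / mu)⁻¹)]
      rw [hq]
      have : lam + mu ≠ 0 := by positivity
      field_simp)
  have hev : ∀ m, evenSeries (lam * t) ((mu - lam) / lam) (lam / mu) m =
      ∑' j : ℕ, (lam * t) ^ (2 * (m + j)) / (2 * (m + j)).factorial * innerSum (lam / mu) m (m + j)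
      + (mu - lam) / lam * oddSeries (lam * t) (lam / mu) m := by
    intro m
    unfold evenSeries oddSeries
    rw [← ((hE1 m).hasSum.add ((hO1 m).hasSum.mul_left _)).tsum_eq]
    refine tsum_congr fun j => ?_
    ring
  refine ⟨fun m => ?_, fun m => ?_, ?_, hO2⟩
  · refine aux_abel (fun j => innerSum (lam / mu) m (m + j)) _
      (fun j => aux_inner_nonneg _ hρ _ _)
      (monotone_nat_of_le_succ fun j => aux_inner_mono _ hρ _ _) ?_ ?_ ?_
    · have h1 := (summable_nat_add_iff m).mpr (Real.hasSum_cosh (lam * t)).summable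
      have h2 := (summable_nat_add_iff m).mpr (Real.hasSum_sinh (lam * t)).summable
      refine (h1.add (h2.mul_left ((mu - lam) / lam))).congr fun j => ?_
      rw [add_comm m j]
    · refine ((hE1 m).add ((hO1 m).mul_left ((mu - lam) / lam))).congr fun j => ?_
      ring
    · intro N
      have h := aux_tail (lam * t) ((mu - lam) / lam) hx hc (m + N)
      simpa only [add_assoc] using h
  · refine tsum_nonneg fun j => mul_nonneg (by positivity) (aux_inner_nonneg _ hρ _ _)
  · have h := hE2.add (hO2.mul_left ((mu - lam) / lam))
    have hval : Real.cosh ((lam + mu) * t) +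
        (mu - lam) / (lam + mu) * Real.sinh ((lam + mu) * t) = Real.cosh ((lam + mu) * t) +
        (mu - lam) / lam * (lam / (lam + mu) * Real.sinh ((lam + mu) * t)) := by
      have : lam + mu ≠ 0 := by positivity
      field_simp
    simp only [hev]
    rw [hval]
    exact h

theorem aux_int_even_odd (f : ℤ → ℝ) (a b : ℝ) (he : HasSum (fun r : ℤ => f (2 * r)) a)
    (ho : HasSum (fun r : ℤ => f (2 * r + 1)) b) : HasSum f (a + b) := by
  have i1 : Function.Injective (fun r : ℤ => 2 * r) := fun a b h => by
    simp only at h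
    omega
  have i2 : Function.Injective (fun r : ℤ => 2 * r + 1) := fun a b h => by
    simp only at h
    omega
  refine HasSum.add_isCompl (s := Set.range fun r : ℤ => 2 * r)
    (t := Set.range fun r : ℤ => 2 * r + 1) ?_ (i1.hasSum_range_iff.mpr he)
    (i2.hasSum_range_iff.mpr ho)
  rw [isCompl_iff, Set.disjoint_left, codisjoint_iff]
  refine ⟨?_, ?_⟩
  · rintro _ ⟨r, rfl⟩ ⟨s, hs⟩
    simp only at hs
    omega
  · ext n
    simp only [Set.sup_eq_union, Set.mem_union, Set.mem_range, Set.top_eq_univ, Set.mem_univ,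
      iff_true]
    rcases Int.even_or_odd' n with ⟨r, h | h⟩
    · exact Or.inl ⟨r, h.symm⟩
    · exact Or.inr ⟨r, h.symm⟩

theorem aux_total (lam mu t : ℝ) (hlam : 0 < lam) (hmu : 0 < mu) :
    Real.exp (-(lam + mu) * t) *
      ((Real.cosh ((lam + mu) * t) + (mu - lam) / (lam + mu) * Real.sinh ((lam + mu) * t)) +
      (lam / (lam + mu) * Real.sinh ((lam + mu) * t) +
        lam / (lam + mu) * Real.sinh ((lam + mu) * t))) = 1 := by
  have h : (Real.cosh ((lam + mu) * t) + (mu - lam) / (lam + mu) * Real.sinh ((lam + mu) * t)) +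
      (lam / (lam + mu) * Real.sinh ((lam + mu) * t) +
        lam / (lam + mu) * Real.sinh ((lam + mu) * t)) = Real.exp ((lam + mu) * t) := by
    rw [← Real.cosh_add_sinh]
    have : lam + mu ≠ 0 := by positivity
    field_simp
    ring
  rw [h, ← Real.exp_add, show -(lam + mu) * t + (lam + mu) * t = 0 by ring, Real.exp_zero]

theorem aux_shift (g : ℕ → ℝ) (S : ℝ) (h : HasSum (fun m : ℤ => g m.natAbs) S) (d : ℤ) :
    HasSum (fun r : ℤ => g (r + d).natAbs) S :=
  ((Equiv.addRight d).hasSum_iff (f := fun m : ℤ => g m.natAbs) (a := S)).mpr h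

/-- The transition probabilities are nonnegative and sum to one over all states. -/
theorem transP_nonneg_sum_one (lam mu : ℝ) (hlam : 0 < lam) (hmu : 0 < mu)
    (k : ℤ) (t : ℝ) (ht : 0 ≤ t) :
    (∀ n : ℤ, 0 ≤ transP lam mu t k n) ∧
    Summable (fun n : ℤ => transP lam mu t k n) ∧
    ∑' n : ℤ, transP lam mu t k n = 1 := by
  obtain ⟨a1, a2, a3, a4⟩ := aux_series lam mu t hlam hmu ht
  obtain ⟨b1, b2, b3, b4⟩ := aux_series mu lam t hmu hlam ht
  have hexp := Real.exp_nonneg (-(lam + mu) * t)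
  refine ⟨fun n => ?_, ?_⟩
  · unfold transP pEE pEO pOE pOO
    split_ifs
    · exact mul_nonneg hexp (a1 _)
    · exact mul_nonneg hexp (add_nonneg (a2 _) (a2 _))
    · exact mul_nonneg hexp (add_nonneg (b2 _) (b2 _))
    · exact mul_nonneg hexp (b1 _)
  suffices h : HasSum (fun n : ℤ => transP lam mu t k n) 1 from ⟨h.summable, h.tsum_eq⟩
  have e0 : ∀ r : ℤ, (2 * r) % 2 = 0 := fun r => by omega
  have e1 : ∀ r : ℤ, ¬ (2 * r + 1) % 2 = 0 := fun r => by omega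
  have e2 : ∀ r : ℤ, (2 * r) / 2 = r := fun r => by omega
  have e3 : ∀ r : ℤ, (2 * r + 1 - 1) / 2 = r := fun r => by omega
  rcases Int.even_or_odd' k with ⟨l, rfl | rfl⟩
  · rw [← aux_total lam mu t hlam hmu, mul_add]
    refine aux_int_even_odd _ _ _ ?_ ?_
    · simp only [transP, e0, e2, if_true, pEE]
      exact (aux_shift _ _ a3 (-l)).mul_left _
    · simp only [transP, e0, e1, e2, e3, if_true, if_false, pEO]
      refine HasSum.mul_left _ (HasSum.add (aux_shift _ _ a4 (-l)) ?_)
      have h := aux_shift _ _ a4 (-l + 1)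
      simpa only [← add_assoc, ← sub_eq_add_neg] using h
  · have htot := aux_total mu lam t hmu hlam
    rw [mul_add, add_comm mu lam] at htot
    rw [← htot, add_comm (Real.exp _ * _) (Real.exp _ * _)]
    refine aux_int_even_odd _ _ _ ?_ ?_
    · simp only [transP, e0, e1, e2, e3, if_true, if_false, pOE]
      rw [add_comm mu lam] at b4
      refine HasSum.mul_left _ (HasSum.add ?_ (aux_shift _ _ b4 (-l)))
      have h := aux_shift _ _ b4 (-l + -1)
      simp only [← add_assoc] at h
      exact h
    · simp only [transP, e1, e3, if_false, pOO]
      rw [add_comm mu lam] at b3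
      exact (aux_shift _ _ b3 (-l)).mul_left _
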